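/- For every n ≥ k ≥ 16, there exists a k-anti-traceable oriented graph on n vertices with independence number exactly ⌈k/2⌉. Concretely: take an independent set X of size ⌈k/2⌉, an arbitrary tournament Y on the remaining n − ⌈k/2⌉ vertices, and an arc from every vertex of Y to every vertex of X; this oriented graph is k-anti-traceable and has independence number ⌈k/2⌉. -/

import Mathlib

variable {V : Type*}

/-- An oriented graph: no 2-cycles (and hence no loops). -/
def Oriented (A : V → V → Prop) : Prop := ∀ u v, A u v → ¬ A v u

/-- `AltPath A b l` : the consecutive vertices of `l` are joined by arcs whose
directions alternate, the first arc being forward iff `b = true`. -/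
def AltPath (A : V → V → Prop) : Bool → List V → Prop
  | _, [] => True
  | _, [_] => True
  | b, x :: y :: rest => (if b then A x y else A y x) ∧ AltPath A (!b) (y :: rest)

/-- An anti-directed path: distinct vertices with alternating arcs. -/
def IsAntiPath (A : V → V → Prop) (l : List V) : Prop :=
  l.Nodup ∧ ∃ b : Bool, AltPath A b l

/-- The induced subdigraph on the vertex set `S` has a hamiltonian anti-directed path. -/
def AntiTraceableOn [DecidableEq V] (A : V → V → Prop) (S : Finset V) : Prop :=
  ∃ l : List V, l.Nodup ∧ l.toFinset = S ∧ ∃ b : Bool, AltPath A b l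

/-- The digraph has a hamiltonian anti-directed path. -/
def AntiTraceable [Fintype V] [DecidableEq V] (A : V → V → Prop) : Prop :=
  AntiTraceableOn A Finset.univ

/-- `k`-anti-traceable: order at least `k` and every induced subdigraph on `k`
vertices has a hamiltonian anti-directed path. -/
def KAntiTraceable [Fintype V] [DecidableEq V] (k : ℕ) (A : V → V → Prop) : Prop :=
  k ≤ Fintype.card V ∧ ∀ S : Finset V, S.card = k → AntiTraceableOn A S

/-- An anti-directed cycle: a cyclic sequence of distinct vertices, of even
length at least 4, in which even-indexed vertices are sources and odd-indexed
vertices are sinks of the two incident arcs. -/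
def AltCycle (A : V → V → Prop) (l : List V) : Prop :=
  l.Nodup ∧ 4 ≤ l.length ∧ l.length % 2 = 0 ∧
  ∀ i : Fin l.length,
    if i.1 % 2 = 0 then
      A (l.get i) (l.get ⟨(i.1 + 1) % l.length, Nat.mod_lt _ (Nat.zero_lt_of_lt i.2)⟩)
    else
      A (l.get ⟨(i.1 + 1) % l.length, Nat.mod_lt _ (Nat.zero_lt_of_lt i.2)⟩) (l.get i)

/-- The arcs among `{a,b,c}` form a subset of the arcs of a directed triangle. -/
def SubDirTriangle (A : V → V → Prop) (a b c : V) : Prop :=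
  (¬ A b a ∧ ¬ A c b ∧ ¬ A a c) ∨ (¬ A a b ∧ ¬ A b c ∧ ¬ A c a)

/-- Every two distinct vertices of `S` are adjacent. -/
def SemicompleteOn (A : V → V → Prop) (S : Finset V) : Prop :=
  ∀ u ∈ S, ∀ v ∈ S, u ≠ v → A u v ∨ A v u

theorem SemicompleteOn.mono {A : V → V → Prop} {S T : Finset V} (h : SemicompleteOn A S)
    (hT : T ⊆ S) : SemicompleteOn A T :=
  fun u hu v hv huv => h u (hT hu) v (hT hv) huv

theorem SemicompleteOn.flip {A : V → V → Prop} {S : Finset V} (h : SemicompleteOn A S) :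
    SemicompleteOn (fun u v => A v u) S :=
  fun u hu v hv huv => (h u hu v hv huv).symm

theorem altPath_flip {A : V → V → Prop} {b : Bool} {l : List V}
    (h : AltPath (fun u v => A v u) b l) : AltPath A (!b) l := by
  induction l generalizing b with
  | nil => trivial
  | cons x l ih =>
    cases l with
    | nil => trivial
    | cons y l =>
      refine ⟨?_, ih h.2⟩
      cases b <;> simpa using h.1

theorem AntiTraceableOn.of_flip [DecidableEq V] {A : V → V → Prop} {S : Finset V}
    (h : AntiTraceableOn (fun u v => A v u) S) : AntiTraceableOn A S := by
  obtain ⟨l, hl, hS, b, hb⟩ := h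
  exact ⟨l, hl, hS, !b, altPath_flip hb⟩

theorem altPath_cons {A : V → V → Prop} {b : Bool} {x : V} {l : List V}
    (hx : ∀ y ∈ l.head?, if b then A x y else A y x) (h : AltPath A (!b) l) :
    AltPath A b (x :: l) := by
  cases l with
  | nil => trivial
  | cons y l => exact ⟨hx y (by simp), h⟩

/-- `x` is the first vertex of an anti-directed path on `n` vertices of `S`
whose first arc leaves `x`. -/
def IsOutOrigin (A : V → V → Prop) (S : Finset V) (n : ℕ) (x : V) : Prop :=
  ∃ l : List V, (x :: l).Nodup ∧ (x :: l).length = n ∧ (∀ v ∈ x :: l, v ∈ S) ∧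
    AltPath A true (x :: l)

theorem IsOutOrigin.cons [DecidableEq V] {A : V → V → Prop} {S : Finset V} {n : ℕ} {x z : V}
    (hx : x ∈ S) (hxz : A x z)
    (h : IsOutOrigin (fun u v => A v u) (S.erase x) n z) : IsOutOrigin A S (n + 1) x := by
  obtain ⟨l, hnd, hlen, hS, halt⟩ := h
  refine ⟨z :: l, ?_, by simp [← hlen], ?_, by simpa using hxz, altPath_flip halt⟩
  · exact List.nodup_cons.2 ⟨fun hm => by simpa using hS x hm, hnd⟩
  · intro v hv
    rcases List.mem_cons.1 hv with rfl | hv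
    · exact hx
    · exact Finset.mem_of_mem_erase (hS v hv)

/-- In a semicomplete digraph, at most one vertex fails to be the origin of an anti-directed
path with outgoing first arc that misses exactly one vertex. -/
theorem isOutOrigin_or [DecidableEq V] (n : ℕ) : ∀ (A : V → V → Prop) (S : Finset V),
    SemicompleteOn A S → S.card = n + 2 → ∀ x ∈ S, ∀ y ∈ S, x ≠ y →
    IsOutOrigin A S (n + 1) x ∨ IsOutOrigin A S (n + 1) y := by
  induction n using Nat.strong_induction_on with
  | _ n ih =>
    intro A S hS hcard x hx y hy hxy
    wlog hA : A x y generalizing x y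
    · exact (this y hy x hx hxy.symm ((hS x hx y hy hxy).resolve_left hA)).symm
    match n, ih, hcard with
    | 0, _, _ => exact Or.inl ⟨[], by simp, by simp, by simpa using hx, trivial⟩
    | 1, _, _ =>
      exact Or.inl ⟨[y], by simpa using hxy, by simp, by simp [hx, hy], by simpa using hA, trivial⟩
    | n + 2, ih, hcard =>
      have key : ∀ u ∈ S, ∀ v ∈ S, ∀ w ∈ S, v ≠ u → w ≠ u → v ≠ w → A u v → A u w →
          IsOutOrigin A S (n + 3) u := by
        intro u hu v hv w hw hvu hwu hvw huv huw
        rcases ih (n + 1) (by omega) (fun u v => A v u) (S.erase u)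
          (hS.flip.mono (Finset.erase_subset _ _))
          (by rw [Finset.card_erase_of_mem hu]; omega) v (by simp [*]) w (by simp [*]) hvw with h | h
        · exact h.cons hu huv
        · exact h.cons hu huw
      by_cases hz : ∃ z ∈ S, z ≠ x ∧ z ≠ y ∧ A x z
      · obtain ⟨z, hzS, hzx, hzy, hxz⟩ := hz
        exact Or.inl (key x hx y hy z hzS hxy.symm hzx hzy.symm hA hxz)
      set R := (S.erase x).erase y with hR
      have hRS : R ⊆ S := (Finset.erase_subset _ _).trans (Finset.erase_subset _ _)
      have hRmem : ∀ v, v ∈ R ↔ v ≠ y ∧ v ≠ x ∧ v ∈ S := by simp [hR]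
      have hRcard : R.card = n + 2 := by
        rw [hR, Finset.card_erase_of_mem (by simp [hy, hxy.symm]), Finset.card_erase_of_mem hx]
        omega
      classical
      by_cases hout : 1 < (R.filter (fun v => A y v)).card
      · obtain ⟨v, hv, w, hw, hvw⟩ := Finset.one_lt_card.1 hout
        simp only [Finset.mem_filter, hRmem] at hv hw
        exact Or.inr (key y hy v hv.1.2.2 w hw.1.2.2 hv.1.1 hw.1.1 hvw hv.2 hw.2)
      have hsum := Finset.card_filter_add_card_filter_not (s := R) (fun v => A y v)
      have hin : ∀ v ∈ R.filter (fun v => ¬ A y v), v ∈ R ∧ A v y := by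
        intro v hv
        simp only [Finset.mem_filter] at hv
        have := (hRmem v).1 hv.1
        exact ⟨hv.1, (hS v this.2.2 y hy this.1).resolve_right hv.2⟩
      left
      obtain ⟨w, hwR, hwy, hw⟩ : ∃ w ∈ R, A w y ∧ IsOutOrigin A R (n + 1) w := by
        match n, ih, hRcard with
        | 0, _, hRcard =>
          obtain ⟨w, hw⟩ : (R.filter (fun v => ¬ A y v)).Nonempty := Finset.card_pos.1 (by omega)
          exact ⟨w, (hin w hw).1, (hin w hw).2, [], by simp, by simp,
            by simpa using (hin w hw).1, trivial⟩
        | n + 1, ih, hRcard =>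
          obtain ⟨v, hv, w, hw, hvw⟩ : ∃ v ∈ R.filter (fun v => ¬ A y v),
              ∃ w ∈ R.filter (fun v => ¬ A y v), v ≠ w := Finset.one_lt_card.1 (by omega)
          rcases ih (n + 1) (by omega) A R (hS.mono hRS) hRcard v (hin v hv).1 w (hin w hw).1 hvw
            with h | h
          · exact ⟨v, (hin v hv).1, (hin v hv).2, h⟩
          · exact ⟨w, (hin w hw).1, (hin w hw).2, h⟩
      obtain ⟨l, hnd, hlen, hl, halt⟩ := hw
      refine ⟨y :: w :: l, ?_, by simp [← hlen], ?_, by simpa using hA, by simpa using hwy, halt⟩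
      · refine List.nodup_cons.2 ⟨fun hm => ?_, List.nodup_cons.2 ⟨fun hm => ?_, hnd⟩⟩
        · rcases List.mem_cons.1 hm with h | h
          · exact hxy h
          · exact ((hRmem x).1 (hl x h)).2.1 rfl
        · exact ((hRmem y).1 (hl y hm)).1 rfl
      · intro v hv
        rcases List.mem_cons.1 hv with rfl | hv
        · exact hx
        rcases List.mem_cons.1 hv with rfl | hv
        · exact hy
        exact hRS (hl v hv)

/-- A semicomplete digraph on `2 ^ k` vertices contains a transitive tournament on `k + 1`
vertices. -/
theorem exists_transitive_list [DecidableEq V] (A : V → V → Prop) (k : ℕ) : ∀ S : Finset V,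
    SemicompleteOn A S → 2 ^ k ≤ S.card →
    ∃ l : List V, l.Nodup ∧ l.length = k + 1 ∧ (∀ v ∈ l, v ∈ S) ∧ l.Pairwise A := by
  classical
  induction k with
  | zero =>
    intro S _ hcard
    obtain ⟨v, hv⟩ : S.Nonempty := Finset.card_pos.1 (by omega)
    exact ⟨[v], by simp, by simp, by simpa using hv, by simp⟩
  | succ k ih =>
    intro S hS hcard
    have hpos : 0 < 2 ^ k := by positivity
    rw [pow_succ] at hcard
    obtain ⟨v, hv⟩ : S.Nonempty := Finset.card_pos.1 (by omega)
    have hsum := Finset.card_filter_add_card_filter_not (s := S.erase v) (fun u => A v u)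
    rw [Finset.card_erase_of_mem hv] at hsum
    have hsub : ∀ (p : V → Prop) [DecidablePred p], (S.erase v).filter p ⊆ S :=
      fun p _ => (Finset.filter_subset _ _).trans (Finset.erase_subset _ _)
    by_cases hout : 2 ^ k ≤ ((S.erase v).filter (fun u => A v u)).card
    · obtain ⟨l, hnd, hlen, hl, hp⟩ := ih _ (hS.mono (hsub _)) hout
      simp only [Finset.mem_filter, Finset.mem_erase] at hl
      refine ⟨v :: l, List.nodup_cons.2 ⟨fun h => (hl v h).1.1 rfl, hnd⟩, by simp [hlen], ?_,
        List.pairwise_cons.2 ⟨fun u hu => (hl u hu).2, hp⟩⟩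
      intro u hu
      rcases List.mem_cons.1 hu with rfl | hu
      · exact hv
      · exact (hl u hu).1.2
    · obtain ⟨l, hnd, hlen, hl, hp⟩ := ih ((S.erase v).filter (fun u => ¬ A v u))
        (hS.mono (hsub _)) (by omega)
      simp only [Finset.mem_filter, Finset.mem_erase] at hl
      refine ⟨l ++ [v], ?_, by simp [hlen], ?_, ?_⟩
      · refine List.nodup_append.2 ⟨hnd, by simp, ?_⟩
        intro u hu w hw
        rw [List.mem_singleton.1 hw]
        exact (hl u hu).1.1
      · intro u hu
        rcases List.mem_append.1 hu with hu | hu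
        · exact (hl u hu).1.2
        · rw [List.mem_singleton.1 hu]; exact hv
      · refine List.pairwise_append.2 ⟨hp, by simp, ?_⟩
        intro u hu w hw
        rw [List.mem_singleton.1 hw]
        exact (hS u (hl u hu).1.2 v hv (hl u hu).1.1).resolve_right (hl u hu).2

/-- Given a transitive tournament on `a, b, c, d, e`, one further vertex `z`, and a vertex `x`
dominating at least three of `a, b, c, d, e`, some anti-directed path on these six vertices can be
prepended to any anti-directed path whose first arc leaves `x`. -/
theorem exists_altPath_prepend {A : V → V → Prop} {a b c d e z x : V} {q : List V}
    (hW : [a, b, c, d, e].Pairwise A)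
    (hz : ∀ w ∈ [a, b, c, d, e], A z w ∨ A w z)
    (hx : [a, b, c, d, e].Triplewise fun u v w => A x u ∨ A x v ∨ A x w)
    (hq : AltPath A true (x :: q)) :
    ∃ p : List V, p.Perm [a, b, c, d, e, z] ∧ AltPath A true (p ++ x :: q) := by
  classical
  simp only [List.triplewise_cons, List.pairwise_cons, List.mem_cons, List.not_mem_nil,
    forall_eq_or_imp, IsEmpty.forall_iff, implies_true, List.Pairwise.nil, and_true,
    List.Triplewise.nil] at hx hW hz
  obtain ⟨⟨hab, hac, had, hae⟩, ⟨hbc, hbd, hbe⟩, ⟨hcd, hce⟩, hde⟩ := hW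
  obtain ⟨hza, hzb, hzc, hzd, hze⟩ := hz
  obtain ⟨-, ⟨⟨hbcd, hbce⟩, hbde⟩, hcde⟩ := hx
  have of_count : ∀ p : List V, (∀ v, p.count v = [a, b, c, d, e, z].count v) →
      AltPath A true (p ++ x :: q) →
      ∃ p : List V, p.Perm [a, b, c, d, e, z] ∧ AltPath A true (p ++ x :: q) :=
    fun p hp h => ⟨p, List.perm_iff_count.2 hp, h⟩
  by_cases h_e : A z e
  · rcases hbcd with h | h | h
    · exact of_count [z, e, c, d, a, b] (fun v => by simp only [List.count_cons]; omega)
        (by simp [AltPath, *])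
    · exact of_count [z, e, b, d, a, c] (fun v => by simp only [List.count_cons]; omega)
        (by simp [AltPath, *])
    · exact of_count [z, e, b, c, a, d] (fun v => by simp only [List.count_cons]; omega)
        (by simp [AltPath, *])
  replace hze := hze.resolve_left h_e
  by_cases h_d : A z d
  · rcases hbce with h | h | h
    · exact of_count [z, d, c, e, a, b] (fun v => by simp only [List.count_cons]; omega)
        (by simp [AltPath, *])
    · exact of_count [z, d, b, e, a, c] (fun v => by simp only [List.count_cons]; omega)
        (by simp [AltPath, *])
    · exact of_count [z, d, b, c, a, e] (fun v => by simp only [List.count_cons]; omega)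
        (by simp [AltPath, *])
  replace hzd := hzd.resolve_left h_d
  by_cases h_a : A a z
  · rcases hcde with h | h | h
    · exact of_count [e, z, a, d, b, c] (fun v => by simp only [List.count_cons]; omega)
        (by simp [AltPath, *])
    · exact of_count [e, z, a, c, b, d] (fun v => by simp only [List.count_cons]; omega)
        (by simp [AltPath, *])
    · exact of_count [d, z, a, c, b, e] (fun v => by simp only [List.count_cons]; omega)
        (by simp [AltPath, *])
  replace hza := hza.resolve_right h_a
  by_cases h_b : A b z
  · rcases hcde with h | h | h
    · exact of_count [e, z, b, d, a, c] (fun v => by simp only [List.count_cons]; omega)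
        (by simp [AltPath, *])
    · exact of_count [e, z, b, c, a, d] (fun v => by simp only [List.count_cons]; omega)
        (by simp [AltPath, *])
    · exact of_count [d, z, b, c, a, e] (fun v => by simp only [List.count_cons]; omega)
        (by simp [AltPath, *])
  replace hzb := hzb.resolve_right h_b
  by_cases h_c : A c z
  · rcases hbde with h | h | h
    · exact of_count [e, z, c, d, a, b] (fun v => by simp only [List.count_cons]; omega)
        (by simp [AltPath, *])
    · exact of_count [z, b, a, e, c, d] (fun v => by simp only [List.count_cons]; omega)
        (by simp [AltPath, *])
    · exact of_count [z, b, a, d, c, e] (fun v => by simp only [List.count_cons]; omega)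
        (by simp [AltPath, *])
  replace hzc := hzc.resolve_right h_c
  rcases hcde with h | h | h
  · exact of_count [d, e, a, b, z, c] (fun v => by simp only [List.count_cons]; omega)
      (by simp [AltPath, *])
  · exact of_count [z, c, a, e, b, d] (fun v => by simp only [List.count_cons]; omega)
      (by simp [AltPath, *])
  · exact of_count [z, c, a, d, b, e] (fun v => by simp only [List.count_cons]; omega)
      (by simp [AltPath, *])

theorem AntiTraceableOn.of_card_le [DecidableEq V] {A : V → V → Prop} {S : Finset V} {l : List V}
    {b : Bool} (hnd : l.Nodup) (hl : ∀ v ∈ l, v ∈ S) (hcard : S.card ≤ l.length)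
    (h : AltPath A b l) : AntiTraceableOn A S :=
  ⟨l, hnd, Finset.eq_of_subset_of_card_le (fun v hv => hl v (List.mem_toFinset.1 hv))
    (by rwa [List.toFinset_card_of_nodup hnd]), b, h⟩

theorem antiTraceableOn_of_transitive_five [DecidableEq V] {A : V → V → Prop} {S : Finset V}
    (hS : SemicompleteOn A S) {a b c d e x y : V} (hWS : ∀ w ∈ [a, b, c, d, e], w ∈ S)
    (hnd : [a, b, c, d, e].Nodup) (hW : [a, b, c, d, e].Pairwise A)
    (hx : x ∈ S \ [a, b, c, d, e].toFinset) (hy : y ∈ S \ [a, b, c, d, e].toFinset) (hxy : x ≠ y)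
    (hxW : [a, b, c, d, e].Triplewise fun u v w => A x u ∨ A x v ∨ A x w)
    (hyW : [a, b, c, d, e].Triplewise fun u v w => A y u ∨ A y v ∨ A y w) :
    AntiTraceableOn A S := by
  set W := [a, b, c, d, e] with hWdef
  set U := S \ W.toFinset with hU
  have hUS : U ⊆ S := Finset.sdiff_subset
  have hUW : ∀ u ∈ U, ∀ w ∈ W, u ≠ w := by
    rintro u hu w hw rfl
    simp [hU, hw] at hu
  have hWcard : W.toFinset.card = 5 := by rw [List.toFinset_card_of_nodup hnd]; simp [hWdef]
  have hcard : U.card + 5 = S.card := by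
    rw [← hWcard]
    exact Finset.card_sdiff_add_card_eq_card fun v hv => hWS v (List.mem_toFinset.1 hv)
  have hU2 : 1 < U.card := Finset.one_lt_card.2 ⟨x, hx, y, hy, hxy⟩
  have main : ∀ u, [a, b, c, d, e].Triplewise (fun v w t => A u v ∨ A u w ∨ A u t) →
      IsOutOrigin A U (U.card - 2 + 1) u → AntiTraceableOn A S := by
    rintro u huW ⟨q, hqnd, hqlen, hqU, hq⟩
    obtain ⟨z, hz⟩ : (U \ (u :: q).toFinset).Nonempty := by
      refine Finset.card_pos.1 ?_
      have := Finset.le_card_sdiff (u :: q).toFinset U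
      rw [List.toFinset_card_of_nodup hqnd] at this
      omega
    simp only [Finset.mem_sdiff, List.mem_toFinset] at hz
    obtain ⟨p, hp, halt⟩ := exists_altPath_prepend (z := z) hW
      (fun w hw => hS z (hUS hz.1) w (hWS w hw) (hUW z hz.1 w hw)) huW hq
    have hmem : ∀ v, v ∈ p ↔ v ∈ W ∨ v = z := by
      intro v
      rw [hp.mem_iff]
      simp [hWdef, or_assoc]
    refine .of_card_le (List.nodup_append.2 ⟨?_, hqnd, ?_⟩) ?_ ?_ halt
    · rw [hp.nodup_iff]
      change (W ++ [z]).Nodup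
      refine List.nodup_append.2 ⟨hnd, by simp, ?_⟩
      intro w hw v hv
      rw [List.mem_singleton.1 hv]
      exact (hUW z hz.1 w hw).symm
    · rintro v hv w hw rfl
      rcases (hmem v).1 hv with h | rfl
      · exact hUW v (hqU v hw) v h rfl
      · exact hz.2 hw
    · intro v hv
      rcases List.mem_append.1 hv with hv | hv
      · rcases (hmem v).1 hv with h | rfl
        · exact hWS v h
        · exact hUS hz.1
      · exact hUS (hqU v hv)
    · rw [List.length_append, hqlen, hp.length_eq]
      simp only [List.length_cons, List.length_nil]
      omega
  rcases isOutOrigin_or (U.card - 2) A U (hS.mono hUS) (by omega) x hx y hy hxy with h | h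
  · exact main x hxW h
  · exact main y hyW h

/-- Every semicomplete digraph on at least sixteen vertices has a hamiltonian anti-directed
path. -/
theorem antiTraceableOn_of_semicompleteOn [DecidableEq V] {A : V → V → Prop} {S : Finset V}
    (hS : SemicompleteOn A S) (hcard : 16 ≤ S.card) : AntiTraceableOn A S := by
  classical
  obtain ⟨W, hnd, hlen, hWS, hW⟩ := exists_transitive_list A 4 S hS hcard
  match W, hlen with
  | [a, b, c, d, e], _ =>
  set U := S \ [a, b, c, d, e].toFinset with hU
  have hUcard : 2 < U.card := by
    have := Finset.le_card_sdiff [a, b, c, d, e].toFinset S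
    rw [List.toFinset_card_of_nodup hnd] at this
    simp only [List.length_cons, List.length_nil, ← hU] at this
    omega
  let p : V → Prop := fun x => [a, b, c, d, e].Triplewise fun u v w => A x u ∨ A x v ∨ A x w
  have hsum := Finset.card_filter_add_card_filter_not (s := U) p
  by_cases hp : 1 < (U.filter p).card
  · obtain ⟨x, hx, y, hy, hxy⟩ := Finset.one_lt_card.1 hp
    rw [Finset.mem_filter] at hx hy
    exact antiTraceableOn_of_transitive_five hS hWS hnd hW hx.1 hy.1 hxy hx.2 hy.2
  · obtain ⟨x, hx, y, hy, hxy⟩ := Finset.one_lt_card.1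
      (show 1 < (U.filter fun x => ¬ p x).card by omega)
    rw [Finset.mem_filter] at hx hy
    have hflip : ∀ x ∈ U, ¬ p x →
        [e, d, c, b, a].Triplewise fun u v w => A u x ∨ A v x ∨ A w x := by
      intro x hx hpx
      have hadj : ∀ w ∈ [a, b, c, d, e], A x w ∨ A w x := by
        intro w hw
        refine hS x (Finset.mem_sdiff.1 hx).1 w (hWS w hw) ?_
        rintro rfl
        exact (Finset.mem_sdiff.1 hx).2 (List.mem_toFinset.2 hw)
      simp only [p, List.triplewise_cons, List.pairwise_cons, List.mem_cons, List.not_mem_nil,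
        forall_eq_or_imp, IsEmpty.forall_iff, implies_true, List.Pairwise.nil, and_true,
        List.Triplewise.nil] at hpx hadj ⊢
      grind
    have hrev : [e, d, c, b, a] = [a, b, c, d, e].reverse := by simp
    have hset : [e, d, c, b, a].toFinset = [a, b, c, d, e].toFinset := by
      rw [hrev, List.toFinset_reverse]
    refine AntiTraceableOn.of_flip (antiTraceableOn_of_transitive_five hS.flip
      (a := e) (b := d) (c := c) (d := b) (e := a) ?_ ?_ ?_ (hset ▸ hx.1) (hset ▸ hy.1) hxy
      (hflip x hx.1 hx.2) (hflip y hy.1 hy.2))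
    · intro w hw
      rw [hrev, List.mem_reverse] at hw
      exact hWS w hw
    · rw [hrev]
      exact List.nodup_reverse.2 hnd
    · rw [hrev]
      exact List.pairwise_reverse.2 hW

/-- When `Y` dominates `X`, an anti-directed path starting outside of `X` with an outgoing arc can
be extended by alternating between equally many vertices of `Y` and of `X`. -/
theorem exists_altPath_zigzag [DecidableEq V] {A : V → V → Prop} {X : Finset V}
    (hYX : ∀ u v : V, u ∉ X → v ∈ X → A u v) (n : ℕ) : ∀ (XS YS : Finset V) (l : List V),
    XS ⊆ X → Disjoint YS X → XS.card = n → YS.card = n → l.Nodup →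
    (∀ v ∈ l, v ∉ XS ∧ v ∉ YS) → (∀ v ∈ l.head?, v ∉ X) → AltPath A true l →
    ∃ m : List V, m.Nodup ∧ m.length = 2 * n + l.length ∧
      (∀ v ∈ m, v ∈ XS ∨ v ∈ YS ∨ v ∈ l) ∧ (∀ v ∈ m.head?, v ∉ X) ∧ AltPath A true m := by
  induction n with
  | zero =>
    intro XS YS l _ _ _ _ hnd _ hhead halt
    exact ⟨l, hnd, by simp, fun v hv => Or.inr (Or.inr hv), hhead, halt⟩
  | succ n ih =>
    intro XS YS l hXS hYS hXc hYc hnd hl hhead halt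
    obtain ⟨x, hx⟩ : XS.Nonempty := Finset.card_pos.1 (by omega)
    obtain ⟨y, hy⟩ : YS.Nonempty := Finset.card_pos.1 (by omega)
    have hyX : y ∉ X := Finset.disjoint_left.1 hYS hy
    have hxX := hXS hx
    have hxYS : x ∉ YS := fun h => Finset.disjoint_left.1 hYS h hxX
    have hxy : y ≠ x := fun h => hyX (h ▸ hxX)
    obtain ⟨m, hm, hlen, hmem, hmhead, hmalt⟩ := ih (XS.erase x) (YS.erase y) (y :: x :: l)
      ((Finset.erase_subset _ _).trans hXS) (hYS.mono_left (Finset.erase_subset _ _))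
      (by rw [Finset.card_erase_of_mem hx]; omega) (by rw [Finset.card_erase_of_mem hy]; omega)
      (by
        simp only [List.nodup_cons, List.mem_cons, not_or]
        exact ⟨⟨hxy, fun h => (hl y h).2 hy⟩, fun h => (hl x h).1 hx, hnd⟩)
      (by
        intro v hv
        simp only [List.mem_cons] at hv
        rcases hv with rfl | rfl | hv
        · exact ⟨fun h => hyX (hXS (Finset.mem_of_mem_erase h)), Finset.notMem_erase _ _⟩
        · exact ⟨Finset.notMem_erase _ _, fun h => hxYS (Finset.mem_of_mem_erase h)⟩
        · exact ⟨fun h => (hl v hv).1 (Finset.mem_of_mem_erase h),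
            fun h => (hl v hv).2 (Finset.mem_of_mem_erase h)⟩)
      (by simpa using hyX)
      ⟨by simpa using hYX y x hyX hxX,
        altPath_cons (fun v hv => by simpa using hYX v x (hhead v hv) hxX) halt⟩
    refine ⟨m, hm, by simp only [hlen, List.length_cons]; omega, ?_, hmhead, hmalt⟩
    intro v hv
    rcases hmem v hv with h | h | h
    · exact Or.inl (Finset.mem_of_mem_erase h)
    · exact Or.inr (Or.inl (Finset.mem_of_mem_erase h))
    · simp only [List.mem_cons] at h
      rcases h with rfl | rfl | h
      · exact Or.inr (Or.inl hy)
      · exact Or.inl hx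
      · exact Or.inr (Or.inr h)

theorem antiTraceableOn_of_dominating [DecidableEq V] {A : V → V → Prop} {X S : Finset V}
    (hYtour : ∀ u v : V, u ∉ X → v ∉ X → u ≠ v → A u v ∨ A v u)
    (hYX : ∀ u v : V, u ∉ X → v ∈ X → A u v) (hS : 16 ≤ S.card)
    (hle : (S ∩ X).card ≤ (S \ X).card + 1) : AntiTraceableOn A S := by
  have hsum := Finset.card_sdiff_add_card_inter S X
  have hsemi : SemicompleteOn A (S \ X) := fun u hu v hv =>
    hYtour u v (Finset.mem_sdiff.1 hu).2 (Finset.mem_sdiff.1 hv).2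
  have hdisj : Disjoint (S \ X) X := Finset.sdiff_disjoint
  rcases Nat.eq_zero_or_pos (S ∩ X).card with h0 | hpos
  · have hSX : S \ X = S := by
      rw [Finset.sdiff_eq_self_iff_disjoint, Finset.disjoint_iff_inter_eq_empty]
      exact Finset.card_eq_zero.1 h0
    exact antiTraceableOn_of_semicompleteOn (hSX ▸ hsemi) hS
  rcases Nat.lt_trichotomy (S ∩ X).card (S \ X).card with hlt | heq | hgt
  · obtain ⟨u, hu⟩ : ∃ u, IsOutOrigin A (S \ X) ((S \ X).card - (S ∩ X).card) u := by
      obtain ⟨T, hT, hTcard⟩ := Finset.exists_subset_card_eq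
        (show (S \ X).card - (S ∩ X).card + 1 ≤ (S \ X).card by omega)
      obtain ⟨x, hx, y, hy, hxy⟩ := Finset.one_lt_card.1 (show 1 < T.card by omega)
      have hor := isOutOrigin_or ((S \ X).card - (S ∩ X).card - 1) A T (hsemi.mono hT)
        (by omega) x hx y hy hxy
      rw [show (S \ X).card - (S ∩ X).card - 1 + 1 = (S \ X).card - (S ∩ X).card by omega] at hor
      rcases hor with ⟨l, h₁, h₂, h₃, h₄⟩ | ⟨l, h₁, h₂, h₃, h₄⟩
      · exact ⟨x, l, h₁, h₂, fun v hv => hT (h₃ v hv), h₄⟩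
      · exact ⟨y, l, h₁, h₂, fun v hv => hT (h₃ v hv), h₄⟩
    obtain ⟨l, hnd, hlen, hl, halt⟩ := hu
    have hlX : ∀ v ∈ u :: l, v ∉ X := fun v hv => (Finset.mem_sdiff.1 (hl v hv)).2
    have hsub : (u :: l).toFinset ⊆ S \ X := fun v hv => hl v (List.mem_toFinset.1 hv)
    obtain ⟨m, hm, hmlen, hmem, -, hmalt⟩ := exists_altPath_zigzag hYX (S ∩ X).card (S ∩ X)
      ((S \ X) \ (u :: l).toFinset) (u :: l) Finset.inter_subset_right
      (hdisj.mono_left Finset.sdiff_subset) rfl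
      (by rw [Finset.card_sdiff_of_subset hsub, List.toFinset_card_of_nodup hnd]; omega) hnd
      (fun v hv => ⟨fun h => hlX v hv (Finset.mem_inter.1 h).2,
        fun h => (Finset.mem_sdiff.1 h).2 (List.mem_toFinset.2 hv)⟩)
      (by simpa using hlX u (by simp)) halt
    refine .of_card_le hm (fun v hv => ?_) (by omega) hmalt
    rcases hmem v hv with h | h | h
    · exact (Finset.mem_inter.1 h).1
    · exact (Finset.mem_sdiff.1 (Finset.mem_sdiff.1 h).1).1
    · exact (Finset.mem_sdiff.1 (hl v h)).1
  · obtain ⟨m, hm, hmlen, hmem, -, hmalt⟩ := exists_altPath_zigzag hYX (S ∩ X).card (S ∩ X)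
      (S \ X) [] Finset.inter_subset_right hdisj rfl heq.symm (by simp) (by simp) (by simp) trivial
    refine .of_card_le hm (fun v hv => ?_) (by simp at hmlen; omega) hmalt
    rcases hmem v hv with h | h | h
    · exact (Finset.mem_inter.1 h).1
    · exact (Finset.mem_sdiff.1 h).1
    · simp at h
  · obtain ⟨x, hx⟩ := Finset.card_pos.1 hpos
    have hxX := (Finset.mem_inter.1 hx).2
    obtain ⟨m, hm, hmlen, hmem, hhead, hmalt⟩ := exists_altPath_zigzag hYX (S \ X).card
      ((S ∩ X).erase x) (S \ X) [] ((Finset.erase_subset _ _).trans Finset.inter_subset_right)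
      hdisj (by rw [Finset.card_erase_of_mem hx]; omega) rfl (by simp) (by simp) (by simp) trivial
    refine .of_card_le (l := x :: m) (b := false) (List.nodup_cons.2 ⟨fun h => ?_, hm⟩)
      (fun v hv => ?_) (by simp at hmlen ⊢; omega)
      (altPath_cons (fun v hv => by simpa using hYX v x (hhead v hv) hxX) hmalt)
    · rcases hmem x h with h | h | h
      · simp at h
      · exact (Finset.mem_sdiff.1 h).2 hxX
      · simp at h
    · rcases List.mem_cons.1 hv with rfl | hv
      · exact (Finset.mem_inter.1 hx).1
      rcases hmem v hv with h | h | h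
      · exact (Finset.mem_inter.1 (Finset.mem_of_mem_erase h)).1
      · exact (Finset.mem_sdiff.1 h).1
      · simp at h

theorem stmt15 [Fintype V] [DecidableEq V] (A : V → V → Prop)
    (n k : ℕ) (hk : 16 ≤ k) (hkn : k ≤ n) (hcard : Fintype.card V = n)
    (X : Finset V) (hX : X.card = (k + 1) / 2)
    (hA : Oriented A)
    (hXind : ∀ u ∈ X, ∀ v ∈ X, ¬ A u v)
    (hYtour : ∀ u v : V, u ∉ X → v ∉ X → u ≠ v → A u v ∨ A v u)
    (hYX : ∀ u v : V, u ∉ X → v ∈ X → A u v) :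
    KAntiTraceable k A ∧
    (∀ S : Finset V, (∀ u ∈ S, ∀ v ∈ S, u ≠ v → ¬ A u v ∧ ¬ A v u) →
      S.card ≤ (k + 1) / 2) ∧
    (∃ S : Finset V, S.card = (k + 1) / 2 ∧
      ∀ u ∈ S, ∀ v ∈ S, u ≠ v → ¬ A u v ∧ ¬ A v u) := by
  refine ⟨⟨by omega, fun S hS => ?_⟩, fun S hS => ?_, X, hX,
    fun u hu v hv _ => ⟨hXind u hu v hv, hXind v hv u hu⟩⟩
  · refine antiTraceableOn_of_dominating hYtour hYX (by omega) ?_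
    have h₁ := Finset.card_sdiff_add_card_inter S X
    have h₂ := Finset.card_le_card (Finset.inter_subset_right : S ∩ X ⊆ X)
    omega
  · by_cases hSX : S ⊆ X
    · exact hX ▸ Finset.card_le_card hSX
    obtain ⟨y, hyS, hyX⟩ := Finset.not_subset.1 hSX
    have h1 : S.card ≤ 1 := by
      refine (Finset.card_le_card (t := {y}) fun u hu => ?_).trans_eq (Finset.card_singleton y)
      rw [Finset.mem_singleton]
      by_contra huy
      obtain ⟨h₁, h₂⟩ := hS u hu y hyS huy
      by_cases huX : u ∈ X
      · exact h₂ (hYX y u hyX huX)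
      · exact (hYtour u y huX hyX huy).elim h₁ h₂
    omega
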